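/- For every integer m ≥ 1 and every real λ < 1, ∑_{n=1}^{∞} 1/( n^m (n−λ) ) = ∑_{j=1}^{m} ∑_{n₁>n₂>⋯>n_m>0} 1/( n₁ · ∏_{i≠j}(n_i−n_j) · (n_j−λ) ), where the inner sum ranges over strictly decreasing tuples (n₁,…,n_m) of positive integers. -/

import Mathlib

open scoped BigOperators

/-- Strictly decreasing `k`-tuples of positive integers. -/
abbrev DecTuple (k : ℕ) := {n : Fin k → ℕ // StrictAnti n ∧ ∀ i, 0 < n i}

namespace DecTuple

/-- The largest entry of a decreasing tuple, with value `0` for the empty tuple. -/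
def top : {k : ℕ} → DecTuple k → ℕ
  | 0, _ => 0
  | _ + 1, u => u.1 0

lemma le_top {k : ℕ} (u : DecTuple k) (i : Fin k) : u.1 i ≤ u.top := by
  cases k with
  | zero => exact i.elim0
  | succ k => exact u.2.1.antitone (Fin.zero_le i)

/-- A decreasing tuple is a shorter one together with the excess of its largest entry. -/
def consEquiv (k : ℕ) : DecTuple k × ℕ ≃ DecTuple (k + 1) where
  toFun p := ⟨Fin.cons (p.1.top + p.2 + 1) p.1.1, by
    constructor
    · intro i j hij
      cases j using Fin.cases with
      | zero => exact absurd hij (Fin.not_lt_zero i)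
      | succ j =>
        cases i using Fin.cases with
        | zero =>
          have := p.1.le_top j
          simp only [Fin.cons_succ, Fin.cons_zero]
          omega
        | succ i => simpa using p.1.2.1 (Fin.succ_lt_succ_iff.mp hij)
    · intro i
      cases i using Fin.cases with
      | zero => simp
      | succ i => simpa using p.1.2.2 i⟩
  invFun u :=
    let v : DecTuple k := ⟨Fin.tail u.1, fun _ _ h => u.2.1 (Fin.succ_lt_succ_iff.mpr h),
      fun i => u.2.2 i.succ⟩
    (v, u.1 0 - v.top - 1)
  left_inv p := by
    rcases p with ⟨u, b⟩
    ext1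
    · simp
    · change u.top + b + 1 - u.top - 1 = b
      omega
  right_inv u := by
    apply Subtype.ext
    funext i
    cases i using Fin.cases with
    | zero =>
      have h : top (⟨Fin.tail u.1, fun _ _ h => u.2.1 (Fin.succ_lt_succ_iff.mpr h),
          fun i => u.2.2 i.succ⟩ : DecTuple k) < u.1 0 := by
        cases k with
        | zero => exact u.2.2 0
        | succ k => exact u.2.1 (Fin.succ_pos 0)
      simp only [Fin.cons_zero]
      omega
    | succ i => simp [Fin.tail]

lemma top_consEquiv {k : ℕ} (p : DecTuple k × ℕ) :
    (consEquiv k p).top = p.1.top + p.2 + 1 := rfl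

lemma prod_consEquiv {k : ℕ} (p : DecTuple k × ℕ) :
    ∏ i, (((consEquiv k p).1 i : ℕ) : ℝ)
      = ((p.1.top + p.2 + 1 : ℕ) : ℝ) * ∏ i, (p.1.1 i : ℝ) := by
  rw [Fin.prod_univ_succ]
  simp [consEquiv]

lemma prod_pos {k : ℕ} (u : DecTuple k) : 0 < ∏ i, (u.1 i : ℝ) :=
  Finset.prod_pos fun i _ => by exact_mod_cast u.2.2 i

instance : Unique (DecTuple 0) where
  default := ⟨Fin.elim0, fun i => i.elim0, fun i => i.elim0⟩
  uniq _ := Subtype.ext (Subsingleton.elim _ _)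

end DecTuple

open DecTuple

/-- Complete homogeneous symmetric function of degree `k` in `1, 1/2, …, 1/n`. -/
noncomputable def harmonicHsymm : ℕ → ℕ → ℝ
  | 0, _ => 1
  | _ + 1, 0 => 0
  | k + 1, n + 1 => harmonicHsymm (k + 1) n + harmonicHsymm k (n + 1) / ((n : ℝ) + 1)

/-- Elementary symmetric function of degree `k` in `1, 1/2, …, 1/n`. -/
noncomputable def harmonicEsymm : ℕ → ℕ → ℝ
  | 0, _ => 1
  | _ + 1, 0 => 0
  | k + 1, n + 1 => harmonicEsymm (k + 1) n + harmonicEsymm k n / ((n : ℝ) + 1)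

/-- Sum over a product of nonnegative terms, computed fibre by fibre. -/
lemma hasSum_prod_of_nonneg {α β : Type*} {f : α × β → ℝ} {g : α → ℝ} {s : ℝ}
    (hf : ∀ p, 0 ≤ f p) (hfib : ∀ a, HasSum (fun b => f (a, b)) (g a)) (hg : HasSum g s) :
    HasSum f s := by
  have hs : Summable f := (summable_prod_of_nonneg hf).2
    ⟨fun a => (hfib a).summable, by simpa only [(hfib _).tsum_eq] using hg.summable⟩
  rw [← (hs.hasSum.prod_fiberwise hfib).unique hg]
  exact hs.hasSum

/-- A product of two convergent sums of nonnegative terms, as a sum over pairs. -/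
lemma hasSum_mul_of_nonneg {α β : Type*} {f : α → ℝ} {g : β → ℝ} {s t : ℝ}
    (hf : ∀ a, 0 ≤ f a) (hg : ∀ b, 0 ≤ g b) (hs : HasSum f s) (ht : HasSum g t) :
    HasSum (fun p : α × β => f p.1 * g p.2) (s * t) :=
  hs.mul ht (hs.summable.mul_of_nonneg ht.summable hf hg)

lemma hasSum_one_div_mul_succ (c : ℝ) (hc : 0 < c) :
    HasSum (fun b : ℕ => 1 / ((c + b + 1) * (c + b))) (1 / c) := by
  rw [hasSum_iff_tendsto_nat_of_nonneg (fun b => by positivity)]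
  have h : ∀ N : ℕ, ∑ b ∈ Finset.range N, 1 / ((c + b + 1) * (c + b)) = 1 / c - 1 / (c + N) := by
    intro N
    induction N with
    | zero => simp
    | succ N ih =>
      rw [Finset.sum_range_succ, ih]
      have : c + N ≠ 0 := by positivity
      have : c + N + 1 ≠ 0 := by positivity
      push_cast
      rw [← add_assoc]
      field_simp
      ring
  simp only [h]
  have : Filter.Tendsto (fun N : ℕ => 1 / (c + (N : ℝ))) Filter.atTop (nhds 0) := by
    simp only [one_div]
    exact (Filter.tendsto_atTop_add_const_left _ c tendsto_natCast_atTop_atTop).inv_tendsto_atTop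
  simpa using this.const_sub (1 / c)

lemma hasSum_decTuple_hsymm (k n : ℕ) :
    HasSum (fun u : DecTuple k => 1 / (((u.top : ℝ) + (n + 1)) * ∏ i, (u.1 i : ℝ)))
      (harmonicHsymm k (n + 1) / ((n : ℝ) + 1)) := by
  induction k generalizing n with
  | zero =>
    convert hasSum_unique (β := DecTuple 0) _ using 1
    simp [harmonicHsymm, top]
  | succ k ih =>
    have key : ∀ x : ℕ, HasSum (fun u : DecTuple (k + 1) =>
        (x : ℝ) / (((u.top : ℝ) + x) * ∏ i, (u.1 i : ℝ))) (harmonicHsymm (k + 1) x) := by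
      intro x
      induction x with
      | zero => simp [harmonicHsymm]
      | succ x ihx =>
        rw [harmonicHsymm]
        have hD : HasSum (fun u : DecTuple (k + 1) => (u.top : ℝ) /
            (((u.top : ℝ) + x + 1) * ((u.top : ℝ) + x) * ∏ i, (u.1 i : ℝ)))
            (harmonicHsymm k (x + 1) / ((x : ℝ) + 1)) := by
          rw [← (consEquiv k).hasSum_iff]
          refine hasSum_prod_of_nonneg (fun p => ?_) (fun u => ?_) (ih x)
          · have := (consEquiv k p).prod_pos
            simp only [Function.comp]
            positivity
          · have hP := u.prod_pos
            have := (hasSum_one_div_mul_succ ((u.top : ℝ) + (x + 1)) (by positivity)).mul_right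
              (1 / ∏ i, (u.1 i : ℝ))
            rw [one_div_mul_one_div] at this
            refine this.congr_fun ?_
            intro b
            simp only [Function.comp, prod_consEquiv, top_consEquiv]
            push_cast
            have : (u.top : ℝ) + b + 1 ≠ 0 := by positivity
            have : (u.top : ℝ) + b + 1 + x + 1 ≠ 0 := by positivity
            field_simp
            ring
        refine (ihx.add hD).congr_fun ?_
        intro u
        have hP := u.prod_pos
        have ht : 0 < (u.top : ℝ) := by exact_mod_cast u.2.2 0
        push_cast
        field_simp
        ring
    have := (key (n + 1)).div_const ((n : ℝ) + 1)
    refine this.congr_fun ?_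
    intro u
    have hP := u.prod_pos
    push_cast
    field_simp

lemma hasSum_decTuple_esymm (k n : ℕ) :
    HasSum (fun u : DecTuple k => if u.top ≤ n then 1 / ∏ i, (u.1 i : ℝ) else 0)
      (harmonicEsymm k n) := by
  induction k generalizing n with
  | zero =>
    convert hasSum_unique (β := DecTuple 0) _ using 1
    simp [harmonicEsymm, top]
  | succ k ih =>
    induction n with
    | zero =>
      rw [harmonicEsymm]
      convert hasSum_zero using 2 with u
      exact if_neg (Nat.not_le.mpr (u.2.2 0))
    | succ n ihn =>
      rw [harmonicEsymm]
      have hD : HasSum (fun u : DecTuple (k + 1) =>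
          if u.top = n + 1 then 1 / ∏ i, (u.1 i : ℝ) else 0)
          (harmonicEsymm k n / ((n : ℝ) + 1)) := by
        rw [← (consEquiv k).hasSum_iff]
        refine hasSum_prod_of_nonneg (fun p => ?_) (fun u => ?_) ((ih n).div_const _)
        · have := (consEquiv k p).prod_pos
          simp only [Function.comp]
          split_ifs <;> positivity
        · have hs := hasSum_single (f := fun b : ℕ =>
            if (consEquiv k (u, b)).top = n + 1 then
              1 / ∏ i, (((consEquiv k (u, b)).1 i : ℕ) : ℝ) else 0) (n - u.top) (by
              intro b hb
              rw [top_consEquiv]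
              exact if_neg (by simp only; omega))
          suffices hv : (if u.top ≤ n then 1 / ∏ i, (u.1 i : ℝ) else 0) / ((n : ℝ) + 1) =
              if (consEquiv k (u, n - u.top)).top = n + 1 then
                1 / ∏ i, (((consEquiv k (u, n - u.top)).1 i : ℕ) : ℝ) else 0 by
            rw [hv]
            exact hs
          simp only [prod_consEquiv, top_consEquiv]
          by_cases h : u.top ≤ n
          · rw [if_pos h, if_pos (by omega), show u.top + (n - u.top) + 1 = n + 1 by omega]
            push_cast
            rw [div_div, mul_comm]
          · rw [if_neg h, if_neg (by omega), zero_div]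
      refine (ihn.add hD).congr_fun ?_
      intro u
      by_cases h : u.top ≤ n
      · rw [if_pos h, if_pos (by omega), if_neg (by omega), add_zero]
      · by_cases h' : u.top = n + 1
        · rw [if_neg h, if_pos h', if_pos h'.le, zero_add]
        · rw [if_neg h, if_neg h', if_neg (by omega), zero_add]

open PowerSeries in
lemma sum_antidiagonal_esymm_mul_hsymm (M n : ℕ) :
    ∑ p ∈ Finset.HasAntidiagonal.antidiagonal M,
      harmonicHsymm p.1 (n + 1) * ((-1) ^ p.2 * harmonicEsymm p.2 n) = 1 / ((n : ℝ) + 1) ^ M := by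
  set H : ℕ → PowerSeries ℝ := fun n => PowerSeries.mk fun k => harmonicHsymm k n with hH
  set E : ℕ → PowerSeries ℝ := fun n => PowerSeries.mk fun k => (-1) ^ k * harmonicEsymm k n with hE
  have hHs : ∀ n : ℕ, H (n + 1) * (1 - PowerSeries.C (1 / ((n : ℝ) + 1)) * X) = H n := by
    intro n
    ext k
    cases k with
    | zero => simp [hH, harmonicHsymm]
    | succ k =>
      rw [mul_sub, mul_one, map_sub, ← mul_assoc, coeff_succ_mul_X, coeff_mul_C]
      simp only [hH, coeff_mk, harmonicHsymm]
      ring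
  have hEs : ∀ n : ℕ, E (n + 1) = E n * (1 - PowerSeries.C (1 / ((n : ℝ) + 1)) * X) := by
    intro n
    ext k
    cases k with
    | zero => simp [hE, harmonicEsymm]
    | succ k =>
      rw [mul_sub, mul_one, map_sub, ← mul_assoc, coeff_succ_mul_X, coeff_mul_C]
      simp only [hE, coeff_mk, harmonicEsymm]
      ring
  have h1 : ∀ n, H n * E n = 1 := by
    intro n
    induction n with
    | zero =>
      have hz : H 0 = 1 ∧ E 0 = 1 := by
        constructor <;> ext k <;> cases k <;> simp [hH, hE, harmonicHsymm, harmonicEsymm, coeff_one]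
      rw [hz.1, hz.2, one_mul]
    | succ n ih =>
      rw [hEs, mul_comm (E n), ← mul_assoc, hHs, ih]
  have h2 : H (n + 1) * E n * (1 - PowerSeries.C (1 / ((n : ℝ) + 1)) * X) = 1 := by
    rw [mul_assoc, ← hEs, h1]
  have h3 : ∀ M, coeff M (H (n + 1) * E n) = 1 / ((n : ℝ) + 1) ^ M := by
    intro M
    induction M with
    | zero => simpa using congrArg (coeff 0) h2
    | succ M ih =>
      have := congrArg (coeff (M + 1)) h2
      rw [mul_sub, mul_one, map_sub, ← mul_assoc, coeff_succ_mul_X, coeff_mul_C, ih,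
        coeff_one, if_neg (Nat.succ_ne_zero M), sub_eq_zero] at this
      rw [this, pow_succ, one_div_mul_one_div]
  rw [← h3 M, coeff_mul]
  simp [hH, hE]

lemma harmonicHsymm_nonneg (k n : ℕ) : 0 ≤ harmonicHsymm k n := by
  induction k generalizing n with
  | zero => simp [harmonicHsymm]
  | succ k ih =>
    induction n with
    | zero => simp [harmonicHsymm]
    | succ n ihn =>
      rw [harmonicHsymm]
      have := ih (n + 1)
      positivity

lemma harmonicEsymm_nonneg (k n : ℕ) : 0 ≤ harmonicEsymm k n := by
  induction k generalizing n with
  | zero => simp [harmonicEsymm]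
  | succ k ih =>
    induction n with
    | zero => simp [harmonicEsymm]
    | succ n ihn =>
      rw [harmonicEsymm]
      have := ih n
      positivity

lemma harmonic_cast_nonneg (n : ℕ) : (0 : ℝ) ≤ harmonic n := by
  have : (0 : ℚ) ≤ harmonic n := Finset.sum_nonneg fun i _ => by positivity
  exact_mod_cast this

lemma harmonic_cast_succ (n : ℕ) : (harmonic (n + 1) : ℝ) = harmonic n + 1 / ((n : ℝ) + 1) := by
  rw [harmonic_succ]
  push_cast
  rw [one_div]

lemma harmonicHsymm_le (k n : ℕ) : harmonicHsymm k n ≤ (harmonic n : ℝ) ^ k := by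
  induction k generalizing n with
  | zero => simp [harmonicHsymm]
  | succ k ih =>
    induction n with
    | zero => simp [harmonicHsymm]
    | succ n ihn =>
      rw [harmonicHsymm]
      have h0 := harmonic_cast_nonneg n
      have hle : (harmonic n : ℝ) ≤ harmonic (n + 1) := by
        rw [harmonic_cast_succ]
        exact le_add_of_nonneg_right (by positivity)
      calc _ ≤ (harmonic n : ℝ) ^ (k + 1) + (harmonic (n + 1) : ℝ) ^ k / ((n : ℝ) + 1) := by
            gcongr
            exact ih _
        _ ≤ (harmonic (n + 1) : ℝ) ^ k * harmonic n
            + (harmonic (n + 1) : ℝ) ^ k / ((n : ℝ) + 1) := by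
            rw [pow_succ]
            gcongr
        _ = _ := by
            rw [pow_succ _ k]
            conv_rhs => rw [harmonic_cast_succ n, mul_add, ← harmonic_cast_succ n]
            ring

lemma harmonicEsymm_le (k n : ℕ) : harmonicEsymm k n ≤ harmonicHsymm k n := by
  induction k generalizing n with
  | zero => simp [harmonicHsymm, harmonicEsymm]
  | succ k ih =>
    induction n with
    | zero => simp [harmonicHsymm, harmonicEsymm]
    | succ n ihn =>
      rw [harmonicHsymm, harmonicEsymm]
      have hmono : harmonicHsymm k n ≤ harmonicHsymm k (n + 1) := by
        cases k with
        | zero => simp [harmonicHsymm]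
        | succ k =>
          rw [harmonicHsymm]
          have := harmonicHsymm_nonneg k (n + 1)
          exact le_add_of_nonneg_right (by positivity)
      gcongr
      exact (ih n).trans hmono

lemma summable_harmonic_pow (M : ℕ) :
    Summable fun n : ℕ => (harmonic (n + 1) : ℝ) ^ M / ((n : ℝ) + 1) ^ 2 := by
  set ε : ℝ := 1 / (2 * ((M : ℝ) + 1)) with hε
  have hε0 : 0 < ε := by positivity
  have hs : Summable fun n : ℕ => (1 + 1 / ε) ^ M * (1 / ((n + 1 : ℕ) : ℝ) ^ (3 / 2 : ℝ)) :=
    ((summable_nat_add_iff 1).2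
      (Real.summable_one_div_nat_rpow.2 (by norm_num : (1 : ℝ) < 3 / 2))).mul_left _
  refine hs.of_nonneg_of_le (fun n => ?_) (fun n => ?_)
  · have := harmonic_cast_nonneg (n + 1)
    positivity
  · have hx1 : (1 : ℝ) ≤ (n : ℝ) + 1 := by simp
    have hx0 : (0 : ℝ) < (n : ℝ) + 1 := by positivity
    push_cast
    set x : ℝ := (n : ℝ) + 1 with hx
    have hH : (harmonic (n + 1) : ℝ) ≤ (1 + 1 / ε) * x ^ ε := by
      have h1 := harmonic_le_one_add_log (n + 1)
      have h2 := Real.log_le_rpow_div hx0.le hε0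
      have h3 := Real.one_le_rpow hx1 hε0.le
      push_cast at h1
      calc _ ≤ 1 + Real.log x := h1
        _ ≤ x ^ ε + x ^ ε / ε := add_le_add h3 h2
        _ = _ := by ring
    have hpow : (x ^ ε) ^ M ≤ x ^ (1 / 2 : ℝ) := by
      rw [← Real.rpow_mul_natCast hx0.le]
      apply Real.rpow_le_rpow_of_exponent_le hx1
      rw [hε, one_div_mul_eq_div, div_le_div_iff₀ (by positivity) (by norm_num)]
      linarith
    have hsplit : x ^ 2 = x ^ (1 / 2 : ℝ) * x ^ (3 / 2 : ℝ) := by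
      rw [← Real.rpow_add hx0, ← Real.rpow_natCast]
      norm_num
    calc (harmonic (n + 1) : ℝ) ^ M / x ^ 2
        ≤ ((1 + 1 / ε) * x ^ ε) ^ M / x ^ 2 := by
          have := harmonic_cast_nonneg (n + 1)
          gcongr
      _ ≤ (1 + 1 / ε) ^ M * x ^ (1 / 2 : ℝ) / x ^ 2 := by
          rw [mul_pow]
          gcongr
      _ = _ := by
          have : 0 < x ^ (1 / 2 : ℝ) := by positivity
          have : 0 < x ^ (3 / 2 : ℝ) := by positivity
          rw [hsplit]
          field_simp

lemma summable_hsymm_mul_esymm (a k : ℕ) (lam : ℝ) (hlam : lam < 1) :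
    Summable fun n : ℕ => harmonicHsymm a (n + 1) / ((n : ℝ) + 1) * harmonicEsymm k n
      * (1 / ((n : ℝ) + 1 - lam)) := by
  obtain ⟨c, hc0, hc⟩ : ∃ c : ℝ, 0 < c ∧ ∀ n : ℕ, c * ((n : ℝ) + 1) ≤ (n : ℝ) + 1 - lam := by
    refine ⟨min 1 (1 - lam), lt_min one_pos (sub_pos.2 hlam), fun n => ?_⟩
    have hn : (0 : ℝ) ≤ n := n.cast_nonneg
    rcases le_total 0 lam with h | h
    · rw [min_eq_right (by linarith)]
      nlinarith
    · rw [min_eq_left (by linarith)]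
      linarith
  refine ((summable_harmonic_pow (a + k)).mul_right (1 / c)).of_nonneg_of_le
    (fun n => ?_) (fun n => ?_)
  all_goals
    have hx : (0 : ℝ) < (n : ℝ) + 1 := by positivity
    have hd : 0 < (n : ℝ) + 1 - lam := (mul_pos hc0 hx).trans_le (hc n)
    have hh := harmonicHsymm_nonneg a (n + 1)
    have he := harmonicEsymm_nonneg k n
  · positivity
  · have h0 := harmonic_cast_nonneg n
    have hle : (harmonic n : ℝ) ≤ harmonic (n + 1) := by
      rw [harmonic_cast_succ]
      exact le_add_of_nonneg_right (by positivity)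
    have hE : harmonicEsymm k n ≤ (harmonic (n + 1) : ℝ) ^ k :=
      (harmonicEsymm_le k n).trans ((harmonicHsymm_le k n).trans (by gcongr))
    calc _ ≤ (harmonic (n + 1) : ℝ) ^ a / ((n : ℝ) + 1) * (harmonic (n + 1) : ℝ) ^ k
          * (1 / (c * ((n : ℝ) + 1))) := by
          have := h0.trans hle
          have := harmonicHsymm_le a (n + 1)
          have := hc n
          gcongr
      _ = _ := by
          rw [pow_add]
          field_simp

namespace DecTuple

/-- Position `a` of a tuple of length `a + 1 + k`. -/
abbrev pivot (a k : ℕ) : Fin (a + 1 + k) := Fin.castAdd k (Fin.last a)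

/-- Split a decreasing tuple at position `a`: the predecessor of the pivot entry, the differences
of the larger entries to it, and (in reverse order) its differences to the smaller entries. -/
def split (a k : ℕ) (n : DecTuple (a + 1 + k)) : ℕ × (DecTuple a × DecTuple k) :=
  (n.1 (pivot a k) - 1,
    ⟨fun i => n.1 (Fin.castAdd k i.castSucc) - n.1 (pivot a k), by
      have hlt : ∀ i : Fin a, n.1 (pivot a k) < n.1 (Fin.castAdd k i.castSucc) := fun i =>
        n.2.1 (by simp [Fin.lt_def])
      refine ⟨fun i j hij => ?_, fun i => Nat.sub_pos_of_lt (hlt i)⟩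
      have h1 : n.1 (Fin.castAdd k j.castSucc) < n.1 (Fin.castAdd k i.castSucc) :=
        n.2.1 (Fin.lt_def.mpr (Fin.lt_def.mp hij))
      have h2 := hlt j
      simp only
      omega⟩,
    ⟨fun i => n.1 (pivot a k) - n.1 (Fin.natAdd (a + 1) i.rev), by
      have hlt : ∀ i : Fin k, n.1 (Fin.natAdd (a + 1) i) < n.1 (pivot a k) := fun i =>
        n.2.1 (by simp [Fin.lt_def]; omega)
      refine ⟨fun i j hij => ?_, fun i => Nat.sub_pos_of_lt (hlt i.rev)⟩
      have h1 : n.1 (Fin.natAdd (a + 1) i.rev) < n.1 (Fin.natAdd (a + 1) j.rev) :=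
        n.2.1 (Nat.add_lt_add_left (Fin.lt_def.mp (Fin.rev_lt_rev.mpr hij)) _)
      have h2 := hlt j.rev
      simp only
      omega⟩)

section

variable {a k : ℕ} (n : DecTuple (a + 1 + k))

lemma split_fst_add_one : (split a k n).1 + 1 = n.1 (pivot a k) :=
  Nat.sub_add_cancel (n.2.2 _)

lemma split_upper_add (i : Fin a) :
    (split a k n).2.1.1 i + n.1 (pivot a k) = n.1 (Fin.castAdd k i.castSucc) :=
  Nat.sub_add_cancel (n.2.1 (by simp [Fin.lt_def])).le

lemma split_lower_add (i : Fin k) :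
    (split a k n).2.2.1 i + n.1 (Fin.natAdd (a + 1) i.rev) = n.1 (pivot a k) :=
  Nat.sub_add_cancel (n.2.1 (by simp [Fin.lt_def]; omega)).le

lemma split_top_add : (split a k n).2.1.top + n.1 (pivot a k) = n.1 ⟨0, by omega⟩ := by
  cases a with
  | zero => exact Nat.zero_add _
  | succ a => exact split_upper_add n 0

lemma split_lower_top_le : (split a k n).2.2.top ≤ (split a k n).1 := by
  have h := split_fst_add_one n
  cases k with
  | zero => exact Nat.zero_le _
  | succ k =>
    have h1 := split_lower_add n 0
    have h2 := n.2.2 (Fin.natAdd (a + 1) (Fin.rev 0))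
    change (split a (k + 1) n).2.2.1 0 ≤ _
    omega

end

lemma split_injective (a k : ℕ) : Function.Injective (split a k) := by
  intro n n' h
  have hp : n.1 (pivot a k) = n'.1 (pivot a k) := by
    rw [← split_fst_add_one, ← split_fst_add_one, h]
  apply Subtype.ext
  funext i
  cases i using Fin.addCases with
  | left i =>
    cases i using Fin.lastCases with
    | last => exact hp
    | cast i => rw [← split_upper_add, ← split_upper_add, h, hp]
  | right i =>
    have h1 := split_lower_add n i.rev
    have h2 := split_lower_add n' i.rev
    rw [Fin.rev_rev] at h1 h2
    rw [h, hp] at h1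
    omega

lemma exists_split_eq {a k : ℕ} (x : ℕ) (u : DecTuple a) (l : DecTuple k) (hl : l.top ≤ x) :
    ∃ n, split a k n = (x, u, l) := by
  set w : Fin (a + 1 + k) → ℕ := Fin.append
    (Fin.snoc (α := fun _ => ℕ) (fun i => u.1 i + (x + 1)) (x + 1) : Fin (a + 1) → ℕ)
    (fun i => x + 1 - l.1 i.rev) with hw
  have hw1 : ∀ i : Fin a, w (Fin.castAdd k i.castSucc) = u.1 i + (x + 1) := by simp [hw]
  have hw2 : w (Fin.castAdd k (Fin.last a)) = x + 1 := by simp [hw]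
  have hw3 : ∀ i : Fin k, w (Fin.natAdd (a + 1) i) = x + 1 - l.1 i.rev := by simp [hw]
  have hlx : ∀ i, 0 < l.1 i ∧ l.1 i ≤ x := fun i => ⟨l.2.2 i, (l.le_top i).trans hl⟩
  have hanti : StrictAnti w := by
    intro i j hij
    cases i using Fin.addCases with
    | left i =>
      cases j using Fin.addCases with
      | left j =>
        cases i using Fin.lastCases with
        | last =>
          rw [Fin.lt_def] at hij
          simp only [Fin.val_castAdd, Fin.val_last] at hij
          omega
        | cast i =>
          cases j using Fin.lastCases with
          | last =>
            rw [hw1, hw2]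
            have := u.2.2 i
            omega
          | cast j =>
            rw [hw1, hw1]
            have := u.2.1 (show i < j from Fin.lt_def.mpr (Fin.lt_def.mp hij))
            omega
      | right j =>
        have := hlx j.rev
        cases i using Fin.lastCases with
        | last =>
          rw [hw2, hw3]
          omega
        | cast i =>
          rw [hw1, hw3]
          omega
    | right i =>
      cases j using Fin.addCases with
      | left j =>
        rw [Fin.lt_def] at hij
        simp only [Fin.val_castAdd, Fin.val_natAdd] at hij
        omega
      | right j =>
        rw [hw3, hw3]
        have := l.2.1 (Fin.rev_lt_rev.mpr (show i < j from
          Fin.lt_def.mpr (Nat.lt_of_add_lt_add_left (Fin.lt_def.mp hij))))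
        have := hlx i.rev
        omega
  have hpos : ∀ i, 0 < w i := by
    intro i
    cases i using Fin.addCases with
    | left i =>
      cases i using Fin.lastCases with
      | last => omega
      | cast i =>
        rw [hw1]
        omega
    | right i =>
      rw [hw3]
      have := hlx i.rev
      omega
  refine ⟨⟨w, hanti, hpos⟩, ?_⟩
  refine Prod.ext ?_ (Prod.ext (Subtype.ext (funext fun i => ?_)) (Subtype.ext (funext fun i => ?_)))
  · change w (pivot a k) - 1 = x
    rw [hw2]
    omega
  · change w _ - w (pivot a k) = u.1 i
    rw [hw1, hw2]
    omega
  · change w (pivot a k) - w _ = l.1 i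
    rw [hw3, hw2, Fin.rev_rev]
    have := hlx i
    omega

lemma prod_erase_pivot {a k : ℕ} (n : DecTuple (a + 1 + k)) :
    ∏ i ∈ Finset.univ.erase (pivot a k), ((n.1 i : ℝ) - (n.1 (pivot a k) : ℝ))
      = (∏ i, ((split a k n).2.1.1 i : ℝ)) * ((-1) ^ k * ∏ i, ((split a k n).2.2.1 i : ℝ)) := by
  have hu : ∀ i : Fin a, (n.1 (Fin.castAdd k i.castSucc) : ℝ) - (n.1 (pivot a k) : ℝ)
      = ((split a k n).2.1.1 i : ℝ) := by
    intro i
    rw [← split_upper_add]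
    push_cast
    ring
  have hl : ∀ i : Fin k, (n.1 (Fin.natAdd (a + 1) i.rev) : ℝ) - (n.1 (pivot a k) : ℝ)
      = -1 * ((split a k n).2.2.1 i : ℝ) := by
    intro i
    rw [← split_lower_add n i]
    push_cast
    ring
  have he : Finset.univ.erase (pivot a k) = Finset.univ.filter (fun i => i ≠ pivot a k) := by
    ext i
    simp
  rw [he, Finset.prod_filter, Fin.prod_univ_add, Fin.prod_univ_castSucc, if_neg (by simp), mul_one]
  congr 1
  · refine Finset.prod_congr rfl fun i _ => ?_
    rw [if_pos (by simp [Fin.ext_iff]; omega), hu]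
  · rw [← Equiv.prod_comp Fin.revPerm]
    simp only [Fin.revPerm_apply]
    rw [← Fin.prod_const k (-1 : ℝ), ← Finset.prod_mul_distrib]
    refine Finset.prod_congr rfl fun i _ => ?_
    rw [if_pos (by simp [Fin.ext_iff]; omega), hl]

end DecTuple

lemma hasSum_pivot (a k : ℕ) (lam : ℝ) (hlam : lam < 1) :
    HasSum (fun n : DecTuple (a + 1 + k) =>
      1 / ((n.1 ⟨0, by omega⟩ : ℝ) *
        (∏ i ∈ Finset.univ.erase (pivot a k), ((n.1 i : ℝ) - (n.1 (pivot a k) : ℝ))) *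
          ((n.1 (pivot a k) : ℝ) - lam)))
      ((-1) ^ k * ∑' n : ℕ, harmonicHsymm a (n + 1) / ((n : ℝ) + 1) * harmonicEsymm k n
        * (1 / ((n : ℝ) + 1 - lam))) := by
  set f : ℕ × (DecTuple a × DecTuple k) → ℝ := fun p =>
    1 / (((p.2.1.top : ℝ) + (p.1 + 1)) * ∏ i, (p.2.1.1 i : ℝ)) *
      (if p.2.2.top ≤ p.1 then 1 / ∏ i, (p.2.2.1 i : ℝ) else 0) * (1 / ((p.1 : ℝ) + 1 - lam))
    with hf
  have hupper : ∀ (n : ℕ) (u : DecTuple a),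
      0 ≤ 1 / (((u.top : ℝ) + (n + 1)) * ∏ i, (u.1 i : ℝ)) := fun n u => by
    have := u.prod_pos
    positivity
  have hlower : ∀ (n : ℕ) (l : DecTuple k),
      0 ≤ (if l.top ≤ n then 1 / ∏ i, (l.1 i : ℝ) else 0) := fun n l => by
    have := l.prod_pos
    split_ifs <;> positivity
  have hfsum : HasSum f (∑' n : ℕ, harmonicHsymm a (n + 1) / ((n : ℝ) + 1) * harmonicEsymm k n
      * (1 / ((n : ℝ) + 1 - lam))) := by
    refine hasSum_prod_of_nonneg (fun p => ?_) (fun n => ?_)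
      (summable_hsymm_mul_esymm a k lam hlam).hasSum
    · have hd : 0 < (p.1 : ℝ) + 1 - lam := by
        have : (0 : ℝ) ≤ p.1 := p.1.cast_nonneg
        linarith
      exact mul_nonneg (mul_nonneg (hupper _ _) (hlower _ _)) (by positivity)
    · have hU := hasSum_decTuple_hsymm a n
      have hL := hasSum_decTuple_esymm k n
      exact (hasSum_mul_of_nonneg (hupper n) (hlower n) hU hL).mul_right _
  have hcomp : HasSum (f ∘ split a k) (∑' n : ℕ, harmonicHsymm a (n + 1) / ((n : ℝ) + 1)
      * harmonicEsymm k n * (1 / ((n : ℝ) + 1 - lam))) := by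
    refine ((split_injective a k).hasSum_iff ?_).2 hfsum
    rintro ⟨x, u, l⟩ hx
    have : ¬ l.top ≤ x := fun hl => hx (exists_split_eq x u l hl)
    simp [hf, this]
  refine (hcomp.mul_left ((-1) ^ k)).congr_fun fun n => ?_
  have h1 : ((split a k n).1 : ℝ) + 1 = n.1 (pivot a k) := by
    exact_mod_cast split_fst_add_one n
  have h2 : ((split a k n).2.1.top : ℝ) + n.1 (pivot a k) = n.1 ⟨0, by omega⟩ := by
    exact_mod_cast split_top_add n
  have h3 : ((-1 : ℝ) ^ k)⁻¹ = (-1) ^ k := by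
    rw [← inv_pow]
    norm_num
  simp only [hf, Function.comp, if_pos (split_lower_top_le n), h1, h2, prod_erase_pivot n,
    one_div, mul_inv, h3]
  ring

/-- For every `m ≥ 1` and every real `λ < 1`,
`∑_{n ≥ 1} 1/(n^m (n-λ))
  = ∑_{j=1}^{m} ∑_{n₁ > ⋯ > n_m > 0} 1/(n₁ ∏_{i ≠ j} (n_i - n_j) (n_j - λ))`,
the inner sums ranging over strictly decreasing tuples of positive integers.
(Here the outer sum is written over `j : Fin m`, i.e. `j` ranging through the
`m` positions of the tuple.) -/
theorem mellin_landen_general (m : ℕ) (hm : 1 ≤ m) (lam : ℝ) (hlam : lam < 1) :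
    ∑' n : ℕ, 1 / (((n : ℝ) + 1) ^ m * (((n : ℝ) + 1) - lam))
      = ∑ j : Fin m,
          ∑' n : {n : Fin m → ℕ // StrictAnti n ∧ ∀ i, 0 < n i},
            1 / ((n.1 ⟨0, by omega⟩ : ℝ) *
              (∏ i ∈ Finset.univ.erase j, ((n.1 i : ℝ) - (n.1 j : ℝ))) *
                ((n.1 j : ℝ) - lam)) := by
  have hterm : ∀ j : Fin m, ∑' n : DecTuple m,
      1 / ((n.1 ⟨0, by omega⟩ : ℝ) *
        (∏ i ∈ Finset.univ.erase j, ((n.1 i : ℝ) - (n.1 j : ℝ))) * ((n.1 j : ℝ) - lam))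
      = ∑' n : ℕ, (-1) ^ (m - 1 - j.1) * (harmonicHsymm j.1 (n + 1) / ((n : ℝ) + 1)
        * harmonicEsymm (m - 1 - j.1) n * (1 / ((n : ℝ) + 1 - lam))) := by
    rintro ⟨a, ha⟩
    obtain ⟨k, rfl⟩ : ∃ k, m = a + 1 + k := ⟨m - (a + 1), by omega⟩
    rw [tsum_mul_left, show a + 1 + k - 1 - a = k by omega]
    exact (hasSum_pivot a k lam hlam).tsum_eq
  rw [Finset.sum_congr rfl fun j _ => hterm j, ← Summable.tsum_finsetSum fun j _ =>
    (summable_hsymm_mul_esymm _ _ lam hlam).mul_left _]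
  refine tsum_congr fun n => ?_
  obtain ⟨M, rfl⟩ : ∃ M, m = M + 1 := ⟨m - 1, by omega⟩
  have key := sum_antidiagonal_esymm_mul_hsymm M n
  rw [Finset.Nat.sum_antidiagonal_eq_sum_range_succ_mk, ← Fin.sum_univ_eq_sum_range
    (fun i => harmonicHsymm i (n + 1) * ((-1) ^ (M - i) * harmonicEsymm (M - i) n))] at key
  rw [pow_succ, mul_assoc, ← one_div_mul_one_div, ← key, Finset.sum_mul]
  refine Finset.sum_congr rfl fun j _ => ?_
  simp only [Nat.add_sub_cancel, one_div, mul_inv]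
  ring
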